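/- Let f be an isoarithmetic IASI with common difference d of a finite simple graph G. In the line graph L(G), label each vertex (an edge e of G) by f⁺(e). Then this vertex labeling of L(G) is injective, and every vertex label and every edge label of L(G) under this labeling is a d-AP-set. -/

import Mathlib

open Pointwise

/-- A finite set of naturals is a `d`-AP-set if `d > 0`, it has at least 3 elements,
and its elements form an arithmetic progression with common difference `d`. -/
def IsAPSet (d : ℕ) (A : Finset ℕ) : Prop :=
  0 < d ∧ 3 ≤ A.card ∧ ∃ a : ℕ, A = (Finset.range A.card).image (fun i => a + i * d)

/-- An integer additive set-indexer (IASI) of a simple graph `G`: an injective labeling of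
vertices by nonempty finite sets of naturals whose induced edge labeling
`f⁺(uv) = f(u) + f(v)` (sumset) is injective on edges. -/
structure IsIASI {V : Type*} (G : SimpleGraph V) (f : V → Finset ℕ) : Prop where
  injective : Function.Injective f
  nonempty : ∀ v, (f v).Nonempty
  edgeInjective : ∀ ⦃u v x y : V⦄, G.Adj u v → G.Adj x y →
    f u + f v = f x + f y → s(u, v) = s(x, y)

/-- An isoarithmetic IASI of `G` with common difference `d`: an IASI all of whose vertex
and edge labels are `d`-AP-sets. -/
def IsIsoarithmeticIASI {V : Type*} (G : SimpleGraph V) (f : V → Finset ℕ) (d : ℕ) : Prop :=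
  IsIASI G f ∧ (∀ v, IsAPSet d (f v)) ∧ (∀ u v, G.Adj u v → IsAPSet d (f u + f v))

theorem isAPSet_image {d : ℕ} (hd : 0 < d) (a : ℕ) {n : ℕ} (hn : 3 ≤ n) :
    IsAPSet d ((Finset.range n).image fun i => a + i * d) := by
  have hcard : ((Finset.range n).image fun i => a + i * d).card = n := by
    rw [Finset.card_image_of_injective, Finset.card_range]
    intro i j hij
    exact Nat.eq_of_mul_eq_mul_right hd (Nat.add_left_cancel hij)
  exact ⟨hd, hcard.symm ▸ hn, a, by rw [hcard]⟩

theorem image_range_add_image_range (a b d : ℕ) {m n : ℕ} (hm : 0 < m) (hn : 0 < n) :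
    (Finset.range m).image (fun i => a + i * d) + (Finset.range n).image (fun i => b + i * d) =
      (Finset.range (m + n - 1)).image fun i => a + b + i * d := by
  ext x
  simp only [Finset.mem_add, Finset.mem_image, Finset.mem_range, exists_exists_and_eq_and]
  constructor
  · rintro ⟨i, hi, j, hj, rfl⟩
    exact ⟨i + j, by omega, by ring⟩
  · rintro ⟨k, hk, rfl⟩
    refine ⟨min k (m - 1), by omega, k - min k (m - 1), by omega, ?_⟩
    have hsplit : k = min k (m - 1) + (k - min k (m - 1)) := by omega
    conv_rhs => rw [hsplit]
    ring

theorem IsAPSet.add {d : ℕ} {A B : Finset ℕ} (hA : IsAPSet d A) (hB : IsAPSet d B) :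
    IsAPSet d (A + B) := by
  obtain ⟨hd, hA3, a, ha⟩ := hA
  obtain ⟨-, hB3, b, hb⟩ := hB
  rw [ha, hb, image_range_add_image_range a b d (by omega) (by omega)]
  exact isAPSet_image hd (a + b) (by omega)

/-- In the line graph `L(G)` of an isoarithmetic IASI graph `G`, labeling each vertex
(i.e., edge `e` of `G`) by `f⁺(e)`, the labeling is injective and every vertex label and
every edge label of `L(G)` is a `d`-AP-set. (Two distinct edges of `G` sharing an endpoint
can always be written as `s(a,b)` and `s(b,c)`.) -/
theorem stmt7 {V : Type*} [Fintype V] (G : SimpleGraph V)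
    (f : V → Finset ℕ) (d : ℕ) (h : IsIsoarithmeticIASI G f d) :
    (∀ ⦃u v x y : V⦄, G.Adj u v → G.Adj x y →
      f u + f v = f x + f y → s(u, v) = s(x, y)) ∧
    (∀ u v, G.Adj u v → IsAPSet d (f u + f v)) ∧
    (∀ a b c, G.Adj a b → G.Adj b c → s(a, b) ≠ s(b, c) →
      IsAPSet d ((f a + f b) + (f b + f c))) := by
  exact ⟨h.1.edgeInjective, h.2.2,
    fun a b c hab hbc _ => (h.2.2 a b hab).add (h.2.2 b c hbc)⟩
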